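/- Consider n samples with correctness indicators c_i ∈ {0,1} and confidences z_i ∈ [0,1]. The supremum over all binning schemes B of the empirical binned ECE is attained by (and equals the binned ECE of) the finest binning that separates distinct confidence values; that is, sup_B ECE_B = Σ_{z ∈ {z_1,…,z_n}} (n_z/n)·|acc_z − z|, where for each distinct confidence value z, n_z = #{i : z_i = z} and acc_z = (Σ_{i : z_i = z} c_i)/n_z. In particular, for any binning scheme B, ECE_B ≤ Σ_z (n_z/n)·|acc_z − z|. -/

import Mathlib

open scoped Classical

/-- The empirical binned expected calibration error of `n` samples with correctness
indicators `c` and confidences `z`, for the binning scheme (partition of `[0,1]`)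
whose bins are the fibers of the bin-assignment function `B`.  The sum ranges exactly
over the bins containing at least one sample. -/
noncomputable def binnedECE {n : ℕ} (c z : Fin n → ℝ) (B : ℝ → ℕ) : ℝ :=
  ∑ j ∈ Finset.image (fun i => B (z i)) Finset.univ,
    ((Finset.univ.filter fun i => B (z i) = j).card : ℝ) / n *
      |(∑ i ∈ Finset.univ.filter fun i => B (z i) = j, c i) /
          ((Finset.univ.filter fun i => B (z i) = j).card : ℝ) -
        (∑ i ∈ Finset.univ.filter fun i => B (z i) = j, z i) /
          ((Finset.univ.filter fun i => B (z i) = j).card : ℝ)|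

/-- The empirical binned ECE of the finest binning, i.e. the binning separating all
distinct confidence values: `∑_{z} (n_z / n) * |acc_z - z|`, the sum ranging over the
distinct confidence values. -/
noncomputable def fineECE {n : ℕ} (c z : Fin n → ℝ) : ℝ :=
  ∑ t ∈ Finset.image z Finset.univ,
    ((Finset.univ.filter fun i => z i = t).card : ℝ) / n *
      |(∑ i ∈ Finset.univ.filter fun i => z i = t, c i) /
          ((Finset.univ.filter fun i => z i = t).card : ℝ) - t|

/-- Coarsening a partition does not increase the sum of the absolute values of the fiber sums. -/
theorem sum_abs_sum_fiber_comp_le {ι α β : Type*} [Fintype ι] [DecidableEq α] [DecidableEq β]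
    (d : ι → ℝ) (f : ι → α) (g : α → β) :
    ∑ b ∈ Finset.image (fun i => g (f i)) Finset.univ,
        |∑ i ∈ Finset.univ.filter fun i => g (f i) = b, d i| ≤
      ∑ a ∈ Finset.image f Finset.univ, |∑ i ∈ Finset.univ.filter fun i => f i = a, d i| := by
  have hmaps : ∀ a ∈ Finset.image f Finset.univ,
      g a ∈ Finset.image (fun i => g (f i)) Finset.univ := by
    simp
  rw [← Finset.sum_fiberwise_of_maps_to hmaps]
  refine Finset.sum_le_sum fun b _ => ?_
  have hfiber : ∀ i ∈ Finset.univ.filter (fun i => g (f i) = b),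
      f i ∈ (Finset.image f Finset.univ).filter (fun a => g a = b) := by
    simp
  rw [← Finset.sum_fiberwise_of_maps_to hfiber]
  refine (Finset.abs_sum_le_sum_abs _ _).trans (Finset.sum_le_sum fun a ha => ?_)
  have hab : g a = b := (Finset.mem_filter.mp ha).2
  refine le_of_eq (congrArg abs (Finset.sum_congr ?_ fun _ _ => rfl))
  ext i
  simp only [Finset.mem_filter, Finset.mem_univ, true_and, and_iff_right_iff_imp]
  rintro rfl
  exact hab

theorem card_div_mul_abs_sub_mean {ι : Type*} (s : Finset ι) (c z : ι → ℝ) (m : ℝ) :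
    (s.card : ℝ) / m * |(∑ i ∈ s, c i) / (s.card : ℝ) - (∑ i ∈ s, z i) / (s.card : ℝ)| =
      |∑ i ∈ s, (c i - z i)| / m := by
  rcases s.eq_empty_or_nonempty with rfl | hs
  · simp
  · have hpos : (0 : ℝ) < s.card := by exact_mod_cast hs.card_pos
    rw [← sub_div, abs_div, abs_of_pos hpos, Finset.sum_sub_distrib]
    field_simp

theorem binnedECE_eq_sum_abs_div {n : ℕ} (c z : Fin n → ℝ) (B : ℝ → ℕ) :
    binnedECE c z B = (∑ j ∈ Finset.image (fun i => B (z i)) Finset.univ,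
      |∑ i ∈ Finset.univ.filter fun i => B (z i) = j, (c i - z i)|) / n := by
  rw [binnedECE, Finset.sum_div]
  exact Finset.sum_congr rfl fun j _ => card_div_mul_abs_sub_mean _ c z n

theorem fineECE_eq_sum_abs_div {n : ℕ} (c z : Fin n → ℝ) :
    fineECE c z = (∑ t ∈ Finset.image z Finset.univ,
      |∑ i ∈ Finset.univ.filter fun i => z i = t, (c i - z i)|) / n := by
  rw [fineECE, Finset.sum_div]
  refine Finset.sum_congr rfl fun t ht => ?_
  rw [← card_div_mul_abs_sub_mean]
  obtain ⟨k, -, hk⟩ := Finset.mem_image.mp ht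
  have hpos : (0 : ℝ) < (Finset.univ.filter fun i => z i = t).card := by
    exact_mod_cast Finset.card_pos.mpr ⟨k, by simpa using hk⟩
  have hmean : (∑ i ∈ Finset.univ.filter fun i => z i = t, z i) /
      ((Finset.univ.filter fun i => z i = t).card : ℝ) = t := by
    rw [Finset.sum_congr rfl fun i hi => (Finset.mem_filter.mp hi).2, Finset.sum_const,
      nsmul_eq_mul, mul_div_cancel_left₀ _ hpos.ne']
  rw [hmean]

theorem binnedECE_le_fineECE {n : ℕ} (c z : Fin n → ℝ) (B : ℝ → ℕ) :
    binnedECE c z B ≤ fineECE c z := by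
  rw [binnedECE_eq_sum_abs_div, fineECE_eq_sum_abs_div]
  exact div_le_div_of_nonneg_right (sum_abs_sum_fiber_comp_le _ z B) n.cast_nonneg

theorem exists_binnedECE_eq_fineECE {n : ℕ} (c z : Fin n → ℝ) :
    ∃ B : ℝ → ℕ, fineECE c z = binnedECE c z B := by
  obtain ⟨B, hB⟩ := Set.countable_iff_exists_injOn.mp (Set.finite_range z).countable
  refine ⟨B, le_antisymm ?_ (binnedECE_le_fineECE c z B)⟩
  have hinv : ∀ i, Function.invFunOn B (Set.range z) (B (z i)) = z i := fun i =>
    hB.leftInvOn_invFunOn (Set.mem_range_self i)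
  have h := sum_abs_sum_fiber_comp_le (fun i => c i - z i) (fun i => B (z i))
    (Function.invFunOn B (Set.range z))
  simp only [hinv] at h
  rw [binnedECE_eq_sum_abs_div, fineECE_eq_sum_abs_div]
  exact div_le_div_of_nonneg_right h n.cast_nonneg

/-- Key step in the proof of Proposition 1 of the paper: for samples with correctness
indicators in `{0,1}` and confidences in `[0,1]`, every binning scheme has empirical
binned ECE at most that of the finest binning separating distinct confidence values,
and the supremum over all binning schemes of the binned ECE equals (is attained by)
the binned ECE of this finest binning. -/
theorem sup_binnedECE_eq_fineECE
    (n : ℕ) (c z : Fin n → ℝ)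
    (hc : ∀ i, c i = 0 ∨ c i = 1)
    (hz : ∀ i, z i ∈ Set.Icc (0 : ℝ) 1) :
    (∀ B : ℝ → ℕ, binnedECE c z B ≤ fineECE c z) ∧
      sSup {e : ℝ | ∃ B : ℝ → ℕ, e = binnedECE c z B} = fineECE c z := by
  refine ⟨binnedECE_le_fineECE c z, IsGreatest.csSup_eq ⟨exists_binnedECE_eq_fineECE c z, ?_⟩⟩
  rintro e ⟨B, rfl⟩
  exact binnedECE_le_fineECE c z B
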